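/- Let S be a Gorenstein normal domain over k and let Λ = End_S(⊕_{i=0}^m M_i) be a non-commutative resolution of S, where M_0 = S and each M_i is an indecomposable Cohen-Macaulay S-module; let φ: S ↪ Λ be the canonical algebra injection and e ∈ Λ the idempotent corresponding to the summand S. Then √Sing(Spec(S)) ≅ Spec( φ(S)/√(φ(S) ∩ ΛeΛ) ) as subschemes of Spec(S). -/

import Mathlib

noncomputable section
attribute [local instance] Classical.propDecidable

open MvPolynomial CategoryTheory

/-- A Noetherian local ring is *regular* if its maximal ideal can be generated by
`d` elements, where `d` is its Krull dimension. -/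
def IsRegularLocal (R : Type) [CommRing R] [IsLocalRing R] : Prop :=
  IsNoetherianRing R ∧
    ∃ s : Finset R, Ideal.span (s : Set R) = IsLocalRing.maximalIdeal R ∧
      (s.card : WithBot (WithTop ℕ)) = ringKrullDim R

/-- The singular locus of `Spec S`: the set of primes `p` such that `S_p` is not regular. -/
def singularSet (S : Type) [CommRing S] : Set (PrimeSpectrum S) :=
  {p | ¬ IsRegularLocal (Localization.AtPrime p.asIdeal)}

/-- The depth of a module over a Noetherian local ring: the supremum of the lengths of
`M`-regular sequences contained in the maximal ideal, with the convention that
`depth M = ∞` when `𝔪 • M = M`. -/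
def moduleDepth (R : Type) [CommRing R] [IsLocalRing R]
    (M : Type) [AddCommGroup M] [Module R M] : WithBot (WithTop ℕ) :=
  if (IsLocalRing.maximalIdeal R) • (⊤ : Submodule R M) = ⊤ then (⊤ : WithTop ℕ)
  else sSup {d : WithBot (WithTop ℕ) | ∃ rs : List R,
    (∀ r ∈ rs, r ∈ IsLocalRing.maximalIdeal R) ∧
      RingTheory.Sequence.IsRegular M rs ∧ d = rs.length}

/-- A finitely generated module `M` over a commutative Noetherian ring `S` of Krull
dimension `d` is *(maximal) Cohen-Macaulay* if `depth (M_𝔪) = d` for every maximal ideal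
`𝔪` of `S`, or `M ≅ 0`. -/
def IsMCM (S : Type) [CommRing S] (M : Type) [AddCommGroup M] [Module S M] : Prop :=
  Subsingleton M ∨ ∀ (m : Ideal S) (hm : m.IsMaximal),
    letI := hm.isPrime
    moduleDepth (Localization.AtPrime m) (LocalizedModule m.primeCompl M) = ringKrullDim S

/-- A linear map factors through a finitely generated projective module
(equivalently, through an object of `add S`). -/
def FactorsThroughProj (S : Type) [CommRing S] {X Y : Type}
    [AddCommGroup X] [Module S X] [AddCommGroup Y] [Module S Y] (f : X →ₗ[S] Y) : Prop :=
  ∃ (P : ModuleCat.{0} S) (g : X →ₗ[S] P) (h : P →ₗ[S] Y),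
    Module.Finite S P ∧ Module.Projective S P ∧ h.comp g = f

/-- The two-sided ideal `[S] ⊆ End_S(M)` of endomorphisms factoring through
a finitely generated projective module. -/
def stabIdeal (S : Type) [CommRing S] (M : Type) [AddCommGroup M] [Module S M] :
    TwoSidedIdeal (Module.End S M) :=
  TwoSidedIdeal.span {f | FactorsThroughProj S f}

/-- The stable endomorphism algebra `End_{CM-bar(S)}(M) = End_S(M)/[S]`,
i.e. the contraction algebra `Λ^M_con`. -/
def StEnd (S : Type) [CommRing S] (M : Type) [AddCommGroup M] [Module S M] : Type :=
  (stabIdeal S M).ringCon.Quotient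

instance (S : Type) [CommRing S] (M : Type) [AddCommGroup M] [Module S M] :
    Ring (StEnd S M) :=
  inferInstanceAs (Ring (stabIdeal S M).ringCon.Quotient)

/-- The reduced ring of the center of a (possibly noncommutative) ring. -/
def RedCenter (A : Type) [Ring A] : Type :=
  (Subring.center A) ⧸ nilradical (Subring.center A)

instance (A : Type) [Ring A] : CommRing (RedCenter A) :=
  inferInstanceAs (CommRing ((Subring.center A) ⧸ nilradical (Subring.center A)))

/-- A commutative Noetherian ring `S` is *Gorenstein* if for every prime ideal `p` of `S`,
writing `S_p` for the localization, `𝔪` for its maximal ideal and `d` for its Krull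
dimension, one has `Ext^i_{S_p}(S_p/𝔪, S_p) = 0` for `i ≠ d` and
`Ext^d_{S_p}(S_p/𝔪, S_p) ≅ S_p/𝔪` (one-dimensional over the residue field). -/
def IsGorenstein (S : Type) [CommRing S] : Prop :=
  ∀ p : PrimeSpectrum S, ∀ i : ℕ,
    (((i : WithBot (WithTop ℕ)) ≠ ringKrullDim (Localization.AtPrime p.asIdeal)) →
      Subsingleton
        (((Ext (Localization.AtPrime p.asIdeal)
            (ModuleCat.{0} (Localization.AtPrime p.asIdeal)) i).obj
          (Opposite.op (ModuleCat.of (Localization.AtPrime p.asIdeal)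
            (IsLocalRing.ResidueField (Localization.AtPrime p.asIdeal))))).obj
          (ModuleCat.of (Localization.AtPrime p.asIdeal)
            (Localization.AtPrime p.asIdeal))))
    ∧ (((i : WithBot (WithTop ℕ)) = ringKrullDim (Localization.AtPrime p.asIdeal)) →
      Nonempty
        ((((Ext (Localization.AtPrime p.asIdeal)
            (ModuleCat.{0} (Localization.AtPrime p.asIdeal)) i).obj
          (Opposite.op (ModuleCat.of (Localization.AtPrime p.asIdeal)
            (IsLocalRing.ResidueField (Localization.AtPrime p.asIdeal))))).obj
          (ModuleCat.of (Localization.AtPrime p.asIdeal)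
            (Localization.AtPrime p.asIdeal)))
          ≃ₗ[Localization.AtPrime p.asIdeal]
            IsLocalRing.ResidueField (Localization.AtPrime p.asIdeal)))

/-- `X'` is a (first) syzygy of `X`: the kernel of a surjection onto `X` from a free
module. -/
def IsSyzygyOf (A : Type) [Ring A] (X' X : ModuleCat.{0} A) : Prop :=
  ∃ (ι : Type) (f : (ι →₀ A) →ₗ[A] X),
    Function.Surjective f ∧ Nonempty (X' ≃ₗ[A] LinearMap.ker f)

/-- `X'` is a `j`-th syzygy `Ω^j X` of `X`. -/
def IsSyzygyIter (A : Type) [Ring A] : ℕ → ModuleCat.{0} A → ModuleCat.{0} A → Prop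
  | 0, X', X => Nonempty (X' ≃ₗ[A] X)
  | (j+1), X', X => ∃ Z : ModuleCat.{0} A, IsSyzygyOf A Z X ∧ IsSyzygyIter A j X' Z

/-- A ring has global dimension `≤ d` when every `d`-th syzygy of any module is
projective. -/
def HasGlobalDimLE (A : Type) [Ring A] (d : ℕ) : Prop :=
  ∀ (X P : ModuleCat.{0} A), IsSyzygyIter A d P X → Module.Projective A P

/-- A ring has finite global dimension. -/
def HasFiniteGlobalDim (A : Type) [Ring A] : Prop :=
  ∃ d : ℕ, HasGlobalDimLE A d

/-- The canonical map `S → End_S(N)`, sending `s` to scalar multiplication by `s`. -/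
def scalarEnd (S : Type) [CommRing S] (N : Type) [AddCommGroup N] [Module S N] :
    S →+* Module.End S N where
  toFun s :=
    { toFun := fun x => s • x
      map_add' := fun x y => smul_add s x y
      map_smul' := fun c x => smul_comm s c x }
  map_one' := by ext x; exact one_smul _ _
  map_mul' := by intro a b; ext x; exact mul_smul a b x
  map_zero' := by ext x; exact zero_smul _ _
  map_add' := by intro a b; ext x; exact add_smul a b x

/-- The preimage in `S` of a two-sided ideal `I ⊆ A` along a ring homomorphism
`ψ : S → A`; when `ψ` is injective this is `ψ(S) ∩ I` viewed as an ideal of `S`. -/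
def pullIdeal (S : Type) [CommRing S] (A : Type) [Ring A]
    (ψ : S →+* A) (I : TwoSidedIdeal A) : Ideal S where
  carrier := {s | ψ s ∈ I}
  add_mem' := by
    intro a b ha hb
    show ψ (a + b) ∈ I
    rw [map_add]; exact I.add_mem ha hb
  zero_mem' := by show ψ 0 ∈ I; rw [map_zero]; exact I.zero_mem
  smul_mem' := by
    intro c x hx
    show ψ (c * x) ∈ I
    rw [map_mul]; exact I.mul_mem_left _ _ hx

/-- An `S`-module is indecomposable when it is nonzero and its only idempotent
endomorphisms are `0` and `1`. -/
def IndecomposableMod (S : Type) [CommRing S] (N : Type) [AddCommGroup N] [Module S N] :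
    Prop :=
  Nontrivial N ∧ ∀ f : Module.End S N, f * f = f → f = 0 ∨ f = 1


section NCRSetup

variable (S : Type) [CommRing S] (m : ℕ) (M : Fin (m + 1) → ModuleCat.{0} S)

/-- The module `M̄ = ⊕_{i=0}^{m} M_i`. -/
abbrev DirSum : Type := (i : Fin (m + 1)) → ↥(M i)

/-- The idempotent `e ∈ Λ = End_S(⊕ M_i)` corresponding to the direct summand `M 0 = S`. -/
def idemZero : Module.End S (DirSum S m M) :=
  (LinearMap.single S (fun i => ↥(M i)) 0).comp (LinearMap.proj 0)

/-- The ideal `φ(S) ∩ ΛeΛ` of `S ≅ φ(S)`, where `φ : S → Λ` is the canonical injection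
and `ΛeΛ` is the two-sided ideal of `Λ` generated by `e`. -/
def idealJ : Ideal S :=
  pullIdeal S (Module.End S (DirSum S m M)) (scalarEnd S (DirSum S m M))
    (TwoSidedIdeal.span {idemZero S m M})

end NCRSetup

section PartA
open RingTheory.Sequence IsLocalRing

/-- vanishing of Ext below n -/
def EV (R : Type) [CommRing R] (N M : Type) [AddCommGroup N] [Module R N]
    [AddCommGroup M] [Module R M] (n : ℕ) : Prop :=
  ∀ i < n, ∀ x : Abelian.Ext (ModuleCat.of R N) (ModuleCat.of R M) i, x = 0

variable {R : Type} [CommRing R]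

lemma ext_smul_eq_zero {N M : ModuleCat.{0} R} (r : R) (hr : ∀ y : N, r • y = 0) (i : ℕ)
    (x : Abelian.Ext N M i) : r • x = 0 := by
  have h : r • 𝟙 N = 0 := by
    ext y
    exact hr y
  have : r • x = (Abelian.Ext.mk₀ (r • 𝟙 N)).comp x (zero_add i) := by
    simp [Abelian.Ext.mk₀_smul, Abelian.Ext.smul_comp]
  rw [this, h]; simp

lemma ext_cov3 {T : ShortComplex (ModuleCat.{0} R)} (hT : T.ShortExact) (X : ModuleCat.{0} R)
    (i : ℕ) (h2 : ∀ z : Abelian.Ext X T.X₂ i, z = 0) (h1 : ∀ z : Abelian.Ext X T.X₁ (i+1), z = 0)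
    (z : Abelian.Ext X T.X₃ i) : z = 0 := by
  obtain ⟨w, rfl⟩ := Abelian.Ext.covariant_sequence_exact₃ X hT z rfl (h1 _)
  rw [h2 w]; simp

lemma ext_cov1 {T : ShortComplex (ModuleCat.{0} R)} (hT : T.ShortExact) (X : ModuleCat.{0} R)
    (i : ℕ) (h3 : ∀ j, j + 1 = i → ∀ z : Abelian.Ext X T.X₃ j, z = 0)
    (z : Abelian.Ext X T.X₁ i) (hz : z.comp (Abelian.Ext.mk₀ T.f) (add_zero i) = 0) : z = 0 := by
  rcases i with _ | i
  · obtain ⟨f, rfl⟩ := (Abelian.Ext.mk₀_bijective _ _).2 z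
    rw [Abelian.Ext.mk₀_comp_mk₀] at hz
    have := (Abelian.Ext.mk₀_bijective _ _).1 (hz.trans (Abelian.Ext.mk₀_zero _ _).symm)
    have hm := hT.mono_f
    rw [← Limits.zero_comp (f := T.f)] at this
    rw [(cancel_mono _).1 this]; simp
  · obtain ⟨w, rfl⟩ := Abelian.Ext.covariant_sequence_exact₁ X hT z hz rfl
    rw [h3 i rfl w]; simp

lemma ext_con2 {T : ShortComplex (ModuleCat.{0} R)} (hT : T.ShortExact) (Y : ModuleCat.{0} R)
    (i : ℕ) (h1 : ∀ z : Abelian.Ext T.X₁ Y i, z = 0) (h3 : ∀ z : Abelian.Ext T.X₃ Y i, z = 0)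
    (z : Abelian.Ext T.X₂ Y i) : z = 0 := by
  obtain ⟨w, rfl⟩ := Abelian.Ext.contravariant_sequence_exact₂ hT Y z (h1 _)
  rw [h3 w]; simp

lemma ext_con1 {T : ShortComplex (ModuleCat.{0} R)} (hT : T.ShortExact) (Y : ModuleCat.{0} R)
    (i : ℕ) (h3 : ∀ z : Abelian.Ext T.X₃ Y (1 + i), z = 0) (z : Abelian.Ext T.X₁ Y i) :
    ∃ (x₂ : Abelian.Ext T.X₂ Y i), (Abelian.Ext.mk₀ T.f).comp x₂ (zero_add i) = z :=
  Abelian.Ext.contravariant_sequence_exact₁ hT Y z rfl (h3 _)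

lemma EV_of_quot {N M : Type} [AddCommGroup N] [Module R N]
    [AddCommGroup M] [Module R M] (x : R) (hx : ∀ y : N, x • y = 0) (reg : IsSMulRegular M x)
    (n : ℕ) (h : EV R N (QuotSMulTop x M) n) : EV R N M (n + 1) := by
  intro i hi z
  have hS := (IsSMulRegular.smulShortComplex_shortExact (M := ModuleCat.of R M) reg)
  refine ext_cov1 hS (ModuleCat.of R N) i (fun j hj w => h j (by omega) w) z ?_
  have : z.comp (Abelian.Ext.mk₀ (x • 𝟙 (ModuleCat.of R M))) (add_zero i) = 0 := by
    rw [Abelian.Ext.mk₀_smul, Abelian.Ext.comp_smul]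
    simpa using ext_smul_eq_zero x hx i z
  exact this

lemma EV_quot {N M : Type} [AddCommGroup N] [Module R N]
    [AddCommGroup M] [Module R M] (x : R) (reg : IsSMulRegular M x)
    (n : ℕ) (h : EV R N M (n + 1)) : EV R N (QuotSMulTop x M) n := by
  intro i hi z
  have hS := (IsSMulRegular.smulShortComplex_shortExact (M := ModuleCat.of R M) reg)
  exact ext_cov3 hS (ModuleCat.of R N) i (h i (by omega)) (h (i+1) (by omega)) z

/-- L1 -/
lemma EV_of_regular {N : Type} [AddCommGroup N] [Module R N] (I : Ideal R)
    (hI : ∀ r ∈ I, ∀ y : N, r • y = 0) (rs : List R) :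
    ∀ (M : Type) [AddCommGroup M] [Module R M], (∀ r ∈ rs, r ∈ I) → IsWeaklyRegular M rs →
    EV R N M rs.length := by
  induction rs with
  | nil => intro M _ _ _ _ i hi; simp at hi
  | cons r rs ih =>
    intro M _ _ hm hreg
    rw [isWeaklyRegular_cons_iff] at hreg
    exact EV_of_quot r (hI r (hm r (by simp))) hreg.1 _
      (ih _ (fun a ha => hm a (by simp [ha])) hreg.2)

/-- L3 -/
lemma exists_regular_of_EV [IsNoetherianRing R] (I : Ideal R) (n : ℕ) :
    ∀ (M : Type) [AddCommGroup M] [Module R M] [Module.Finite R M], EV R (R ⧸ I) M n →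
    ∃ rs : List R, rs.length = n ∧ (∀ r ∈ rs, r ∈ I) ∧ IsWeaklyRegular M rs := by
  induction n with
  | zero => intro M _ _ _ _; exact ⟨[], by simp⟩
  | succ n ih =>
    intro M _ _ _ h
    have h0 : Subsingleton ((R ⧸ I) →ₗ[R] M) := by
      refine ⟨fun f g => ?_⟩
      have e : ∀ f : (R ⧸ I) →ₗ[R] M, f = 0 := by
        intro f
        have := h 0 (by omega) (Abelian.Ext.mk₀ (ModuleCat.ofHom f))
        have := (Abelian.Ext.mk₀_bijective _ _).1 (this.trans (Abelian.Ext.mk₀_zero _ _).symm)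
        simpa using congrArg ModuleCat.Hom.hom this
      rw [e f, e g]
    obtain ⟨r, hr, hreg⟩ := IsSMulRegular.subsingleton_linearMap_iff.1 h0
    rw [Ideal.annihilator_quotient] at hr
    obtain ⟨rs, h1, h2, h3⟩ := ih (QuotSMulTop r M) (EV_quot r hreg n h)
    refine ⟨r :: rs, by simp [h1], ?_, ?_⟩
    · simpa using ⟨hr, h2⟩
    · rw [isWeaklyRegular_cons_iff]; exact ⟨hreg, h3⟩

lemma EV_equiv {N N' M : Type} [AddCommGroup N] [Module R N] [AddCommGroup N'] [Module R N']
    [AddCommGroup M] [Module R M] (e : N ≃ₗ[R] N') (n : ℕ) (h : EV R N' M n) : EV R N M n := by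
  intro i hi x
  have := h i hi ((Abelian.Ext.mk₀ e.symm.toModuleIso.hom).comp x (zero_add i))
  have h2 := congrArg (fun t => (Abelian.Ext.mk₀ e.toModuleIso.hom).comp t (zero_add i)) this
  simp only [Abelian.Ext.mk₀_comp_mk₀_assoc, Abelian.Ext.comp_zero] at h2
  have h3 : e.toModuleIso.hom ≫ e.symm.toModuleIso.hom = 𝟙 _ := by ext; simp
  rw [h3] at h2
  simpa using h2

lemma EV_devissage [IsNoetherianRing R] (M : Type) [AddCommGroup M] [Module R M]
    (n e : ℕ) (h : ∀ p : PrimeSpectrum R, ringKrullDim (R ⧸ p.asIdeal) ≤ e →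
      EV R (R ⧸ p.asIdeal) M n)
    (N : Type) [AddCommGroup N] [Module R N] [hf : Module.Finite R N] :
      Module.supportDim R N ≤ e → EV R N M n := by
  induction hf using
      IsNoetherianRing.induction_on_isQuotientEquivQuotientPrime R with
  | subsingleton N =>
    intro _ i hi x
    have : (𝟙 (ModuleCat.of R N)) = 0 := by ext y; exact Subsingleton.elim _ _
    rw [← Abelian.Ext.mk₀_id_comp x, this]; simp
  | quotient N p f =>
    intro hd
    refine EV_equiv f _ (h p ?_)
    rw [← Module.supportDim_quotient_eq_ringKrullDim]
    exact (Module.supportDim_le_of_injective _ f.symm.injective).trans hd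
  | exact N₁ N₂ N₃ f g hf hg hfg h₁ h₃ =>
    intro hd i hi x
    let T : ShortComplex (ModuleCat.{0} R) := ShortComplex.mk (ModuleCat.ofHom f)
      (ModuleCat.ofHom g) (by ext y; simpa using hfg.apply_apply_eq_zero y)
    have hT : T.ShortExact :=
      { exact := (ShortComplex.ShortExact.moduleCat_exact_iff_function_exact _).mpr hfg
        mono_f := (ModuleCat.mono_iff_injective _).mpr hf
        epi_g := (ModuleCat.epi_iff_surjective _).mpr hg }
    exact ext_con2 hT (ModuleCat.of R M) i
      (h₁ ((Module.supportDim_le_of_injective _ hf).trans hd) i hi)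
      (h₃ ((Module.supportDim_le_of_surjective _ hg).trans hd) i hi) x

/-- L2 (Ischebeck) -/
lemma EV_ischebeck [IsNoetherianRing R] [IsLocalRing R] (M : Type) [AddCommGroup M] [Module R M]
    [Module.Finite R M] (n : ℕ) (h : EV R (R ⧸ maximalIdeal R) M n) (e : ℕ) :
    ∀ (N : Type) [AddCommGroup N] [Module R N] [Module.Finite R N],
      Module.supportDim R N ≤ e → EV R N M (n - e) := by
  induction e with
  | zero =>
    intro N _ _ hN
    refine EV_devissage M n 0 ?_ N
    intro p hp
    have : p.asIdeal = maximalIdeal R := by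
      have : Ring.KrullDimLE 0 (R ⧸ p.asIdeal) := by
        rw [Ring.krullDimLE_iff]; exact_mod_cast hp
      have := (Ring.KrullDimLE.isField_of_isDomain (R := R ⧸ p.asIdeal))
      exact IsLocalRing.eq_maximalIdeal (Ideal.Quotient.maximal_of_isField _ this)
    rw [this]; exact h
  | succ e ih =>
    intro N _ _ hN
    refine EV_devissage M _ (e+1) ?_ N
    intro p hp i hi x
    by_cases hpm : p.asIdeal = maximalIdeal R
    · have h' : EV R (R ⧸ p.asIdeal) M n := by rw [hpm]; exact h
      exact h' i (by omega) x
    obtain ⟨r, hrm, hrp⟩ : ∃ r ∈ maximalIdeal R, r ∉ p.asIdeal := by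
      by_contra! hc
      exact hpm (le_antisymm (IsLocalRing.le_maximalIdeal p.2.ne_top) hc)
    have reg : IsSMulRegular (R ⧸ p.asIdeal) r := by
      rw [isSMulRegular_quotient_iff_mem_of_smul_mem]
      intro y hy
      exact (p.2.mem_or_mem hy).resolve_left hrp
    have hd : Module.supportDim R (QuotSMulTop r (R ⧸ p.asIdeal)) ≤ e := by
      have := Module.supportDim_quotSMulTop_succ_eq_supportDim reg hrm
      rw [Module.supportDim_quotient_eq_ringKrullDim] at this
      rw [← this] at hp
      push_cast at hp
      exact (ENat.WithBot.add_le_add_one_right_iff).1 hp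
    have hE := ih _ hd
    have hS := (IsSMulRegular.smulShortComplex_shortExact
      (M := ModuleCat.of R (R ⧸ p.asIdeal)) reg)
    have hsurj : ∀ y : Abelian.Ext (ModuleCat.of R (R ⧸ p.asIdeal)) (ModuleCat.of R M) i,
        ∃ z : Abelian.Ext (ModuleCat.of R (R ⧸ p.asIdeal)) (ModuleCat.of R M) i,
        (Abelian.Ext.mk₀ (r • 𝟙 (ModuleCat.of R (R ⧸ p.asIdeal)))).comp z (zero_add i) = y :=
      ext_con1 hS (ModuleCat.of R M) i (hE (1+i) (by omega))
    have hsub : Subsingleton (Abelian.Ext (ModuleCat.of R (R ⧸ p.asIdeal)) (ModuleCat.of R M) i) := by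
      by_contra hns
      have hnt := not_subsingleton_iff_nontrivial.1 hns
      have : r ∈ (Module.annihilator R (Abelian.Ext (ModuleCat.of R (R ⧸ p.asIdeal))
          (ModuleCat.of R M) i)).jacobson :=
        (IsLocalRing.maximalIdeal_le_jacobson _) hrm
      refine absurd ?_ (Submodule.top_ne_pointwise_smul_of_mem_jacobson_annihilator this)
      rw [eq_comm, eq_top_iff]
      intro y hy
      obtain ⟨z, hz⟩ := hsurj y
      have hz2 : r • z = y := by
        rw [← hz, Abelian.Ext.mk₀_smul, Abelian.Ext.smul_comp, Abelian.Ext.mk₀_id_comp]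
      rw [← hz2]
      exact Submodule.smul_mem_pointwise_smul _ _ ⊤ trivial
    exact Subsingleton.elim _ _
end PartA

section PartB
open RingTheory.Sequence IsLocalRing

variable {R : Type} [CommRing R]

def GenLE (R : Type) [CommRing R] [IsLocalRing R] (n : ℕ) : Prop :=
  ∃ s : Finset R, Ideal.span (s : Set R) = maximalIdeal R ∧ s.card ≤ n

lemma exchange [IsLocalRing R] (s : Finset R) (hs : Ideal.span (s : Set R) = maximalIdeal R)
    (x : R) (hx : x ∈ maximalIdeal R) (hx2 : x ∉ maximalIdeal R ^ 2) :
    ∃ t : Finset R, t.card + 1 ≤ s.card ∧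
      Ideal.span (insert x (t : Set R)) = maximalIdeal R := by
  have hx' := hx
  rw [← hs, Ideal.span, Submodule.mem_span_finset'] at hx'
  obtain ⟨a, ha⟩ := hx'
  have : ∃ j : s, IsUnit (a j) := by
    by_contra! hcon
    apply hx2
    rw [← ha, pow_two]
    refine Ideal.sum_mem _ fun j _ => ?_
    refine Ideal.mul_mem_mul (hcon j) ?_
    rw [← hs]; exact Ideal.subset_span j.2
  obtain ⟨j, hj⟩ := this
  refine ⟨s.erase j, ?_, ?_⟩
  · rw [Finset.card_erase_of_mem j.2]
    have := Finset.card_pos.mpr ⟨_, j.2⟩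
    omega
  · apply le_antisymm
    · rw [Ideal.span_le]
      intro y hy
      rcases hy with rfl | hy
      · exact hx
      · rw [← hs]; exact Ideal.subset_span (Finset.mem_of_mem_erase hy)
    · rw [← hs, Ideal.span_le]
      intro y hy
      by_cases hyj : y = j
      · subst hyj
        have h1 : a j • (j : R) ∈ Ideal.span (insert x ((s.erase j : Finset R) : Set R)) := by
          have e : a j • (j : R) = x - ∑ i ∈ Finset.univ.erase j, a i • (i : R) := by
            rw [← ha, ← Finset.add_sum_erase _ _ (Finset.mem_univ j)]; ring
          rw [e]
          refine Ideal.sub_mem _ (Ideal.subset_span (Or.inl rfl)) (Ideal.sum_mem _ fun i hi => ?_)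
          refine Ideal.mul_mem_left _ _ (Ideal.subset_span (Or.inr ?_))
          rw [Finset.mem_coe, Finset.mem_erase]
          exact ⟨fun h => Finset.ne_of_mem_erase hi (Subtype.ext h), i.2⟩
        exact (Ideal.unit_mul_mem_iff_mem _ hj).mp h1
      · exact Ideal.subset_span (Or.inr (by simp [hyj]; exact hy))

lemma isLocalRing_quot [IsLocalRing R] {x : R} (hx : x ∈ maximalIdeal R) :
    IsLocalRing (R ⧸ Ideal.span {x}) := by
  have : Nontrivial (R ⧸ Ideal.span {x}) := Ideal.Quotient.nontrivial_iff.mpr (by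
    intro h
    have : Ideal.span {x} ≤ maximalIdeal R := by simpa [Ideal.span_le] using hx
    rw [h] at this
    exact (maximalIdeal.isMaximal R).ne_top (top_le_iff.mp this))
  exact IsLocalRing.of_surjective' _ Ideal.Quotient.mk_surjective

lemma genLE_quot [IsLocalRing R] {n : ℕ} (h : GenLE R (n+1)) (x : R) (hx : x ∈ maximalIdeal R)
    (hx2 : x ∉ maximalIdeal R ^ 2) [IsLocalRing (R ⧸ Ideal.span {x})] :
    GenLE (R ⧸ Ideal.span {x}) n := by
  obtain ⟨s, hs, hc⟩ := h
  obtain ⟨t, ht, hsp⟩ := exchange s hs x hx hx2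
  refine ⟨t.image (Ideal.Quotient.mk _), ?_, Finset.card_image_le.trans (by omega)⟩
  rw [← IsLocalRing.map_maximalIdeal_of_surjective (Ideal.Quotient.mk (Ideal.span {x}))
    Ideal.Quotient.mk_surjective, ← hsp, Ideal.map_span, Set.image_insert_eq]
  have : Ideal.Quotient.mk (Ideal.span {x}) x = 0 :=
    Ideal.Quotient.eq_zero_iff_mem.mpr (Ideal.mem_span_singleton_self x)
  rw [this, Ideal.span_insert_zero]
  simp

lemma exists_regular_notMem [IsNoetherianRing R] [IsLocalRing R] (M : Type) [AddCommGroup M]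
    [Module R M] [Module.Finite R M] (h : ∃ r ∈ maximalIdeal R, IsSMulRegular M r)
    (h2 : ¬ maximalIdeal R ≤ maximalIdeal R ^ 2) :
    ∃ x ∈ maximalIdeal R, x ∉ maximalIdeal R ^ 2 ∧ IsSMulRegular M x := by
  by_contra! hcon
  have := (Ideal.subset_union_prime_finite (s := insert (maximalIdeal R ^ 2) (associatedPrimes R M))
    ((associatedPrimes.finite R M).insert _) (f := id) (maximalIdeal R ^ 2) (maximalIdeal R ^ 2)
    (fun i hi h _ => (hi.resolve_left h).isPrime) (I := maximalIdeal R)).1 (by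
      intro x hx
      by_cases hx2 : x ∈ maximalIdeal R ^ 2
      · exact Set.mem_biUnion (Or.inl rfl) hx2
      · have := hcon x hx hx2
        have h3 : x ∈ ⋃ p ∈ associatedPrimes R M, (p : Set R) := by
          rw [biUnion_associatedPrimes_eq_compl_regular R M]; exact this
        rw [Set.biUnion_insert]
        exact Or.inr h3)
  obtain ⟨i, hi, hle⟩ := this
  rcases hi with rfl | hi
  · exact h2 hle
  · obtain ⟨r, hr, hreg⟩ := h
    have h3 : r ∈ ⋃ p ∈ associatedPrimes R M, (p : Set R) := Set.mem_biUnion hi (hle hr)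
    rw [biUnion_associatedPrimes_eq_compl_regular R M] at h3
    exact h3 hreg

lemma max_eq_bot_of_le_sq [IsNoetherianRing R] [IsLocalRing R]
    (h2 : maximalIdeal R ≤ maximalIdeal R ^ 2) : maximalIdeal R = ⊥ := by
  apply Submodule.eq_bot_of_le_smul_of_le_jacobson_bot (maximalIdeal R) _
    (IsNoetherian.noetherian _) _ (IsLocalRing.maximalIdeal_le_jacobson _)
  rwa [smul_eq_mul, ← pow_two]

lemma free_of_max_bot [IsLocalRing R] (h : maximalIdeal R = ⊥) (M : Type) [AddCommGroup M]
    [Module R M] : Module.Free R M := by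
  let := (IsLocalRing.isField_iff_maximalIdeal_eq.mpr h).toField
  exact Module.Free.of_divisionRing R M

theorem free_of_gen_reg (n : ℕ) : ∀ (R : Type) [CommRing R] [IsNoetherianRing R] [IsLocalRing R]
    (M : Type) [AddCommGroup M] [Module R M] [Module.Finite R M], GenLE R n →
    (∃ rs : List R, rs.length = n ∧ (∀ r ∈ rs, r ∈ maximalIdeal R) ∧ IsWeaklyRegular M rs) →
    Module.Free R M := by
  induction n with
  | zero =>
    rintro R _ _ _ M _ _ _ ⟨s, hs, hc⟩ -
    apply free_of_max_bot
    have : s = ∅ := by simpa using hc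
    rw [← hs, this]; simp
  | succ n ih =>
    rintro R _ _ _ M _ _ _ hg ⟨rs, hl, hm, hw⟩
    by_cases h2 : maximalIdeal R ≤ maximalIdeal R ^ 2
    · exact free_of_max_bot (max_eq_bot_of_le_sq h2) M
    have hE : EV R (R ⧸ maximalIdeal R) M (n+1) := by
      rw [← hl]
      refine EV_of_regular (maximalIdeal R) ?_ rs M hm hw
      intro r hr y
      obtain ⟨z, rfl⟩ := Ideal.Quotient.mk_surjective y
      rw [← Ideal.Quotient.mk_eq_mk, ← Submodule.Quotient.mk_smul, Submodule.Quotient.mk_eq_zero]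
      exact Ideal.mul_mem_right _ _ hr
    obtain ⟨x, hx, hx2, hreg⟩ := exists_regular_notMem M (by
      match rs, hl with
      | r :: rs', _ =>
        exact ⟨r, hm r (by simp), ((isWeaklyRegular_cons_iff _ _ _).1 hw).1⟩) h2
    have hq := EV_quot x hreg n hE
    obtain ⟨ts, htl, htm, htw⟩ := exists_regular_of_EV (maximalIdeal R) n _ hq
    have := isLocalRing_quot hx
    have : Module.Finite (R ⧸ Ideal.span {x}) (QuotSMulTop x M) :=
      Module.Finite.of_restrictScalars_finite R _ _
    have : Module.FinitePresentation R M := Module.finitePresentation_of_finite R M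
    have := ih (R ⧸ Ideal.span {x}) (QuotSMulTop x M) (genLE_quot hg x hx hx2)
      ⟨ts.map (algebraMap R _), by simpa using htl, by
        intro r hr
        obtain ⟨t, ht, rfl⟩ := List.mem_map.mp hr
        rw [← IsLocalRing.map_maximalIdeal_of_surjective (Ideal.Quotient.mk (Ideal.span {x}))
          Ideal.Quotient.mk_surjective]
        exact Ideal.mem_map_of_mem _ (htm t ht),
        (isWeaklyRegular_map_algebraMap_iff _ _ _).2 htw⟩
    exact (Module.free_quotSMulTop_iff_free R M
      (IsLocalRing.maximalIdeal_le_jacobson _ hx) hreg).1 this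
end PartB

section PartB2
open RingTheory.Sequence IsLocalRing

lemma ht_add_quot_le (R : Type) [CommRing R] (q : Ideal R) [hq : q.IsPrime] :
    (q.height : WithBot ℕ∞) + ringKrullDim (R ⧸ q) ≤ ringKrullDim R := by
  have : Nonempty (PrimeSpectrum R) := ⟨⟨q, hq⟩⟩
  rw [ringKrullDim_quotient]
  have e : PrimeSpectrum.zeroLocus (q : Set R) = Set.Ici (⟨q, hq⟩ : PrimeSpectrum R) := by
    ext p
    rfl
  rw [e, ← Order.coheight_eq_krullDim_Ici]
  have e2 : q.height = Order.height (⟨q, hq⟩ : PrimeSpectrum R) := PrimeSpectrum.height_eq_orderHeight ⟨q, hq⟩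
  rw [e2]
  rw [ringKrullDim, Order.krullDim_eq_iSup_height_add_coheight_of_nonempty]
  norm_cast
  exact le_iSup (fun a : PrimeSpectrum R => Order.height a + Order.coheight a) ⟨q, hq⟩

lemma exists_nat_dim (d : WithBot ℕ∞) (hnb : d ≠ ⊥) (hfin : d ≠ ⊤) :
    ∃ e : ℕ, d = (e : WithBot ℕ∞) := by
  induction d with
  | bot => exact absurd rfl hnb
  | coe d =>
    induction d with
    | top => exact absurd rfl hfin
    | coe d => exact ⟨d, rfl⟩

lemma quot_smul_zero {R : Type} [CommRing R] (I : Ideal R) (r : R) (hr : r ∈ I) (y : R ⧸ I) :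
    r • y = 0 := by
  obtain ⟨z, rfl⟩ := Ideal.Quotient.mk_surjective y
  rw [← Ideal.Quotient.mk_eq_mk, ← Submodule.Quotient.mk_smul, Submodule.Quotient.mk_eq_zero]
  exact Ideal.mul_mem_right _ _ hr

theorem free_loc (R : Type) [CommRing R] [IsNoetherianRing R] [IsLocalRing R]
    (N : Type) [AddCommGroup N] [Module R N] [Module.Finite R N]
    (rs : List R) (hm : ∀ r ∈ rs, r ∈ maximalIdeal R) (hw : IsWeaklyRegular N rs)
    (hlen : ringKrullDim R ≤ (rs.length : WithBot ℕ∞))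
    (T : Submonoid R) (A : Type) [CommRing A] [IsLocalRing A] [Algebra R A] [IsLocalization T A]
    (N' : Type) [AddCommGroup N'] [Module R N'] [Module A N'] [IsScalarTower R A N']
    (f : N →ₗ[R] N') (hf : IsBaseChange A f) (hreg : IsRegularLocal A) : Module.Free A N' := by
  obtain ⟨hA, s, hs, hsc⟩ := hreg
  set q : Ideal R := (maximalIdeal A).under R with hq
  have hqp : q.IsPrime := inferInstance
  have hE : EV R (R ⧸ maximalIdeal R) N rs.length :=
    EV_of_regular (maximalIdeal R) (quot_smul_zero _) rs N hm hw
  have hfin : ringKrullDim (R ⧸ q) ≠ ⊤ := by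
    intro h
    have := ringKrullDim_quotient_le q
    rw [h, top_le_iff] at this
    exact (ringKrullDim_ne_top (R := R)) this
  have hnb : ringKrullDim (R ⧸ q) ≠ ⊥ := by
    have : Nontrivial (R ⧸ q) := Ideal.Quotient.nontrivial_iff.mpr hqp.ne_top
    intro h
    have := ringKrullDim_nonneg_of_nontrivial (R := R ⧸ q)
    rw [h] at this
    exact absurd this (by simp)
  obtain ⟨e, he⟩ : ∃ e : ℕ, ringKrullDim (R ⧸ q) = (e : WithBot ℕ∞) := by
    exact exists_nat_dim _ hnb hfin
  have hE2 := EV_ischebeck N rs.length hE e (R ⧸ q) (by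
    rw [Module.supportDim_quotient_eq_ringKrullDim, he])
  obtain ⟨ts, htl, htm, htw⟩ := exists_regular_of_EV q _ N hE2
  have hle : s.card ≤ ts.length := by
    have h1 := ht_add_quot_le R q
    rw [hq, IsLocalization.height_under T, IsLocalRing.maximalIdeal_height_eq_ringKrullDim, ← hq,
      ← hsc, he] at h1
    have h2 := h1.trans hlen
    have h3 : s.card + e ≤ rs.length := by
      have h2 : ((s.card + e : ℕ) : WithBot ℕ∞) ≤ rs.length := by
        rw [Nat.cast_add]; exact h2
      exact ENat.natCast_le_natCast.mp (WithBot.coe_le_coe.mp h2)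
    omega
  have : Module.Flat R A := IsLocalization.flat A T
  have hw' := htw.of_flat_of_isBaseChange hf
  have : Module.Finite A N' := Module.Finite.equiv hf.equiv
  refine free_of_gen_reg ts.length A N' ⟨s, hs, hle⟩ ⟨_, by simp, ?_, hw'⟩
  intro r hr
  obtain ⟨t, ht, rfl⟩ := List.mem_map.mp hr
  exact htm t ht

lemma mcm_subsingleton_aux (R : Type) [CommRing R] [IsLocalRing R]
    (N : Type) [AddCommGroup N] [Module R N] [Module.Finite R N]
    (h : maximalIdeal R • (⊤ : Submodule R N) = ⊤) : Subsingleton N := by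
  have := Submodule.eq_bot_of_le_smul_of_le_jacobson_bot (maximalIdeal R) (⊤ : Submodule R N)
    Module.Finite.fg_top h.ge (IsLocalRing.maximalIdeal_le_jacobson _)
  exact Submodule.subsingleton_iff R |>.mp (subsingleton_of_bot_eq_top this.symm)

theorem mcm_loc_free (S : Type) [CommRing S] [IsNoetherianRing S] (M : Type) [AddCommGroup M]
    [Module S M] [Module.Finite S M] (hM : IsMCM S M) (p : Ideal S) [hp : p.IsPrime]
    (hreg : IsRegularLocal (Localization.AtPrime p)) :
    Module.Free (Localization.AtPrime p) (LocalizedModule p.primeCompl M) := by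
  rcases hM with hM | hM
  · have : Subsingleton (LocalizedModule p.primeCompl M) := inferInstance
    infer_instance
  obtain ⟨m, hm, hpm⟩ := Ideal.exists_le_maximal p hp.ne_top
  have hmp := hm.isPrime
  have hd := hM m hm
  let R := Localization.AtPrime m
  let A := Localization.AtPrime p
  let N := LocalizedModule m.primeCompl M
  let N' := LocalizedModule p.primeCompl M
  have hle : m.primeCompl ≤ p.primeCompl := fun x hx h => hx (hpm h)
  let : Algebra R A := IsLocalization.localizationAlgebraOfSubmonoidLe R A m.primeCompl p.primeCompl hle
  have : IsScalarTower S R A :=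
    IsLocalization.localization_isScalarTower_of_submonoid_le R A m.primeCompl p.primeCompl hle
  have hloc : IsLocalization (Submonoid.map (algebraMap S R) p.primeCompl) A :=
    IsLocalization.isLocalization_of_submonoid_le R A m.primeCompl p.primeCompl hle
  have : IsNoetherianRing R := IsLocalization.isNoetherianRing m.primeCompl R inferInstance
  let : Module R N' := Module.compHom N' (algebraMap R A)
  have : IsScalarTower R A N' := ⟨fun x y z => by
    rw [Algebra.smul_def, mul_smul]; rfl⟩
  have : IsScalarTower S R N' := ⟨fun x y z => by
    change (algebraMap R A (x • y)) • z = x • (algebraMap R A y • z)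
    rw [Algebra.smul_def, map_mul, ← IsScalarTower.algebraMap_apply, mul_smul, algebraMap_smul]⟩
  have hb1 : IsBaseChange R (LocalizedModule.mkLinearMap m.primeCompl M) :=
    IsLocalizedModule.isBaseChange m.primeCompl R _
  have hb2 : IsBaseChange A (LocalizedModule.mkLinearMap p.primeCompl M) :=
    IsLocalizedModule.isBaseChange p.primeCompl A _
  let f : N →ₗ[R] N' := hb1.lift (LocalizedModule.mkLinearMap p.primeCompl M)
  have hf : IsBaseChange A f := by
    refine IsBaseChange.of_comp hb1 (h := f) ?_
    have : (f.restrictScalars S) ∘ₗ (LocalizedModule.mkLinearMap m.primeCompl M) =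
      LocalizedModule.mkLinearMap p.primeCompl M := by
      ext x
      exact hb1.lift_eq _ x
    rw [this]; exact hb2
  have hNfin : Module.Finite R N := Module.Finite.equiv hb1.equiv
  by_cases hsub : maximalIdeal R • (⊤ : Submodule R N) = ⊤
  · have : Subsingleton N := mcm_subsingleton_aux R N hsub
    have : Subsingleton N' := hf.equiv.symm.toEquiv.subsingleton
    exact inferInstanceAs (Module.Free A N')
  · change moduleDepth R N = _ at hd
    rw [moduleDepth, if_neg hsub] at hd
    have hdim : ringKrullDim R ≤ ringKrullDim S := by
      rw [IsLocalization.AtPrime.ringKrullDim_eq_height m R]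
      exact Ideal.height_le_ringKrullDim_of_isPrime
    obtain ⟨e, he⟩ := exists_nat_dim (ringKrullDim R) ringKrullDim_ne_bot ringKrullDim_ne_top
    rw [← hd, he] at hdim
    obtain ⟨rs, hrm, hrw, hrl⟩ : ∃ rs : List R, (∀ r ∈ rs, r ∈ maximalIdeal R) ∧
        IsWeaklyRegular N rs ∧ e ≤ rs.length := by
      cases e with
      | zero => exact ⟨[], by simp, by simp, by simp⟩
      | succ e =>
        have h1 : ((e : ℕ) : WithBot (WithTop ℕ)) < ((e + 1 : ℕ) : WithBot (WithTop ℕ)) :=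
          WithBot.coe_lt_coe.mpr (ENat.natCast_lt_natCast.mpr (Nat.lt_succ_self e))
        obtain ⟨_, ⟨rs, h3, h4, rfl⟩, h5⟩ := lt_sSup_iff.mp (h1.trans_le hdim)
        refine ⟨rs, h3, h4.toIsWeaklyRegular, ?_⟩
        exact ENat.natCast_lt_natCast.mp (WithBot.coe_lt_coe.mp h5)
    refine free_loc R N rs hrm hrw ?_ (Submonoid.map (algebraMap S R) p.primeCompl) A N' f hf hreg
    rw [he]
    exact WithBot.coe_le_coe.mpr (ENat.natCast_le_natCast.mpr hrl)
end PartB2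

section PartC
open RingTheory.Sequence IsLocalRing

def PD (R : Type) [CommRing R] (N : Type) [AddCommGroup N] [Module R N] (n : ℕ) : Prop :=
  HasProjectiveDimensionLT (ModuleCat.of R N) n

variable {R : Type} [CommRing R] {N N' : Type} [AddCommGroup N] [Module R N]
  [AddCommGroup N'] [Module R N'] {L : Type} [AddCommGroup L] [Module R L]

lemma PD_zero [Subsingleton N] : PD R N 0 := by
  have : Limits.IsZero (ModuleCat.of R N) := ModuleCat.isZero_of_subsingleton _
  exact this.hasProjectiveDimensionLT_zero

lemma subsingleton_of_PD (h : PD R N 0) : Subsingleton N := by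
  have := (hasProjectiveDimensionLT_zero_iff_isZero (ModuleCat.of R N)).1 h
  exact ModuleCat.subsingleton_of_isZero this

lemma PD_one_iff : PD R N 1 ↔ Module.Projective R N := by
  rw [IsProjective.iff_projective, projective_iff_hasProjectiveDimensionLT_one]; rfl

lemma PD_mono {n m : ℕ} (h : PD R N n) (hm : n ≤ m) : PD R N m := by
  unfold PD at *
  exact hasProjectiveDimensionLT_of_ge _ n m hm

lemma PD_retract {n : ℕ} (h : PD R N n) (i : N' →ₗ[R] N) (r : N →ₗ[R] N')
    (hir : ∀ x, r (i x) = x) : PD R N' n := by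
  unfold PD at *
  have e : Retract (ModuleCat.of R N') (ModuleCat.of R N) :=
    { i := ModuleCat.ofHom i, r := ModuleCat.ofHom r, retract := by ext x; exact hir x }
  exact e.hasProjectiveDimensionLT n

lemma PD_equiv {n : ℕ} (h : PD R N n) (e : N ≃ₗ[R] N') : PD R N' n :=
  PD_retract h e.symm.toLinearMap e.toLinearMap (by simp)

def mkSC (f : N →ₗ[R] N') (g : N' →ₗ[R] L) (hfg : Function.Exact f g) :
    ShortComplex (ModuleCat.{0} R) where
  X₁ := ModuleCat.of R N
  X₂ := ModuleCat.of R N'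
  X₃ := ModuleCat.of R L
  f := ModuleCat.ofHom f
  g := ModuleCat.ofHom g
  zero := by ext x; exact hfg.apply_apply_eq_zero x

lemma mkSC_exact (f : N →ₗ[R] N') (g : N' →ₗ[R] L) (hf : Function.Injective f)
    (hfg : Function.Exact f g) (hg : Function.Surjective g) : (mkSC f g hfg).ShortExact where
  exact := (ShortComplex.ShortExact.moduleCat_exact_iff_function_exact _).mpr hfg
  mono_f := (ModuleCat.mono_iff_injective _).mpr hf
  epi_g := (ModuleCat.epi_iff_surjective _).mpr hg

lemma PD_ses1 (f : N →ₗ[R] N') (g : N' →ₗ[R] L) (hf : Function.Injective f)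
    (hfg : Function.Exact f g) (hg : Function.Surjective g) {n : ℕ}
    (h2 : PD R N' n) (h3 : PD R L (n+1)) : PD R N n :=
  (mkSC_exact f g hf hfg hg).hasProjectiveDimensionLT_X₁ n h2 h3

lemma PD_ses3 (f : N →ₗ[R] N') (g : N' →ₗ[R] L) (hf : Function.Injective f)
    (hfg : Function.Exact f g) (hg : Function.Surjective g) {n : ℕ}
    (h1 : PD R N n) (h2 : PD R N' (n+1)) : PD R L (n+1) :=
  (mkSC_exact f g hf hfg hg).hasProjectiveDimensionLT_X₃ n h1 h2

lemma PD_ker {n : ℕ} (h : PD R L (n+2)) [Module.Projective R N'] (g : N' →ₗ[R] L)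
    (hg : Function.Surjective g) : PD R (LinearMap.ker g) (n+1) :=
  PD_ses1 (LinearMap.ker g).subtype g (Submodule.injective_subtype _)
    (LinearMap.exact_subtype_ker_map g) hg (PD_mono (PD_one_iff.2 inferInstance) (by omega)) h

lemma PD_of_ker {n : ℕ} [Module.Projective R N'] (g : N' →ₗ[R] L)
    (hg : Function.Surjective g) (h : PD R (LinearMap.ker g) (n+1)) : PD R L (n+2) :=
  PD_ses3 (LinearMap.ker g).subtype g (Submodule.injective_subtype _)
    (LinearMap.exact_subtype_ker_map g) hg h (PD_mono (PD_one_iff.2 inferInstance) (by omega))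

lemma proj_quot (x : R) [Module.Projective R N] :
    Module.Projective (R ⧸ Ideal.span {x}) (QuotSMulTop x N) :=
  Module.Projective.of_equiv ((QuotSMulTop.equivQuotTensor x N).extendScalarsOfSurjective
    Ideal.Quotient.mk_surjective).symm

lemma quotMap_inj (x : R) (f : N →ₗ[R] N') (g : N' →ₗ[R] L) (hf : Function.Injective f)
    (hfg : Function.Exact f g) (hL : IsSMulRegular L x) :
    Function.Injective (QuotSMulTop.map x f) := by
  rw [injective_iff_map_eq_zero]
  intro a ha
  obtain ⟨a, rfl⟩ := Submodule.Quotient.mk_surjective _ a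
  rw [QuotSMulTop.map_apply_mk, Submodule.Quotient.mk_eq_zero] at ha
  obtain ⟨b, -, hb⟩ := ha
  have hb : x • b = f a := hb
  have : g b = 0 := by
    apply hL
    show x • g b = x • 0
    rw [← map_smul, hb, hfg.apply_apply_eq_zero, smul_zero]
  obtain ⟨c, rfl⟩ := (hfg b).1 this
  rw [← map_smul] at hb
  rw [Submodule.Quotient.mk_eq_zero, ← hf hb]
  exact Submodule.smul_mem_pointwise_smul _ _ _ trivial

lemma PD_quot_step (x : R) (f : N →ₗ[R] N') (g : N' →ₗ[R] L) (hf : Function.Injective f)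
    (hfg : Function.Exact f g) (hg : Function.Surjective g) (hL : IsSMulRegular L x) {n : ℕ}
    [Module.Projective R N'] (h : PD (R ⧸ Ideal.span {x}) (QuotSMulTop x N) (n+1)) :
    PD (R ⧸ Ideal.span {x}) (QuotSMulTop x L) (n+2) := by
  have hs : Function.Surjective (algebraMap R (R ⧸ Ideal.span {x})) :=
    Ideal.Quotient.mk_surjective
  have h2 : PD (R ⧸ Ideal.span {x}) (QuotSMulTop x N') (n+2) :=
    PD_mono (PD_one_iff.2 (proj_quot x)) (by omega)
  exact PD_ses3 ((QuotSMulTop.map x f).extendScalarsOfSurjective hs)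
    ((QuotSMulTop.map x g).extendScalarsOfSurjective hs)
    (quotMap_inj x f g hf hfg hL) (QuotSMulTop.map_exact x hfg hg)
    (QuotSMulTop.map_surjective x hg) h h2

theorem PD_quot (x : R) (hx : IsSMulRegular R x) (n : ℕ) : ∀ (N : Type) [AddCommGroup N]
    [Module R N], IsSMulRegular N x → PD R N (n+1) →
    PD (R ⧸ Ideal.span {x}) (QuotSMulTop x N) (n+1) := by
  induction n with
  | zero =>
    intro N _ _ hN h
    have := PD_one_iff.1 h
    exact PD_one_iff.2 (proj_quot x)
  | succ n ih =>
    intro N _ _ hN h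
    let g : (N →₀ R) →ₗ[R] N := Finsupp.linearCombination R id
    have hg : Function.Surjective g := Finsupp.linearCombination_id_surjective R N
    have hK := PD_ker h g hg
    have hF : IsSMulRegular (N →₀ R) x := by
      intro a b hab
      ext i
      exact hx (DFunLike.congr_fun hab i)
    have hKreg : IsSMulRegular (LinearMap.ker g) x := by
      intro a b hab
      exact Subtype.ext (hF (congrArg Subtype.val hab))
    have hK' := ih _ hKreg hK
    exact PD_quot_step x (LinearMap.ker g).subtype g (Submodule.injective_subtype _)
      (LinearMap.exact_subtype_ker_map g) hg hN hK'

lemma PD_residue_of_cyclic [IsLocalRing R] {n : ℕ} (h : PD R N n) (v : N) (hv : v ≠ 0)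
    (hsp : ∀ y : N, ∃ r : R, r • v = y) (hk : ∀ r ∈ maximalIdeal R, r • v = 0) :
    PD R (R ⧸ maximalIdeal R) n := by
  have hker : LinearMap.ker (LinearMap.toSpanSingleton R N v) = maximalIdeal R := by
    refine ((maximalIdeal.isMaximal R).eq_of_le ?_ ?_).symm
    · intro h
      have : (1 : R) ∈ LinearMap.ker (LinearMap.toSpanSingleton R N v) := by rw [h]; trivial
      exact hv (by simpa using this)
    · intro r hr
      exact hk r hr
  have e := LinearMap.quotKerEquivOfSurjective (LinearMap.toSpanSingleton R N v) hsp
  rw [hker] at e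
  exact PD_equiv h e.symm
end PartC

section PartC2
open RingTheory.Sequence IsLocalRing

variable {R : Type} [CommRing R] {N N' : Type} [AddCommGroup N] [Module R N]
  [AddCommGroup N'] [Module R N'] {L : Type} [AddCommGroup L] [Module R L]

lemma free_mem_smul_top [IsLocalRing R] [Module.Free R N] (z : R) (hz : z ≠ 0)
    (y : N) (hy : z • y = 0) : y ∈ maximalIdeal R • (⊤ : Submodule R N) := by
  let b := Module.Free.chooseBasis R N
  rw [← b.linearCombination_repr y, Finsupp.linearCombination_apply]
  refine Submodule.sum_mem _ fun i _ => Submodule.smul_mem_smul ?_ trivial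
  rw [mem_maximalIdeal, mem_nonunits_iff]
  intro hu
  apply hz
  have h1 : z * b.repr y i = 0 := by
    have := DFunLike.congr_fun (congrArg b.repr hy) i
    simpa using this
  rwa [hu.mul_left_eq_zero] at h1

lemma smul_eq_zero_of_mem [IsLocalRing R] (z : R) (hz2 : ∀ r ∈ maximalIdeal R, r * z = 0)
    (y : N) (hy : y ∈ maximalIdeal R • (⊤ : Submodule R N)) : z • y = 0 := by
  induction hy using Submodule.smul_induction_on' with
  | smul r hr n hn => rw [smul_smul, mul_comm, hz2 r hr, zero_smul]
  | add x hx y hy h1 h2 => rw [smul_add, h1, h2, add_zero]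

lemma split_of_depth_zero [IsLocalRing R] (z : R) (hz : z ≠ 0)
    (hz2 : ∀ r ∈ maximalIdeal R, r * z = 0) [Module.Free R N] [Module.Finite R N]
    [Module.Free R N'] [Module.Finite R N'] (f : N →ₗ[R] N') (hf : Function.Injective f) :
    ∃ l : N' →ₗ[R] N, l ∘ₗ f = LinearMap.id := by
  rw [IsLocalRing.split_injective_iff_lTensor_residueField_injective, injective_iff_map_eq_zero]
  intro a ha
  have hker : ∀ (X : Type) [AddCommGroup X] [Module R X],
      LinearMap.ker (TensorProduct.mk R (ResidueField R) X 1) = maximalIdeal R • ⊤ :=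
    fun X _ _ => LinearMap.ker_tensorProductMk X (I := maximalIdeal R)
  obtain ⟨y, rfl⟩ := TensorProduct.mk_surjective R N (ResidueField R) residue_surjective a
  have h1 : f y ∈ maximalIdeal R • (⊤ : Submodule R N') := by
    rw [← hker]; exact ha
  have h2 := smul_eq_zero_of_mem z hz2 _ h1
  rw [← map_smul] at h2
  have h3 : z • y = 0 := hf (h2.trans (map_zero f).symm)
  have h4 := free_mem_smul_top z hz y h3
  rw [← hker] at h4
  exact h4

theorem projective_of_depth_zero [IsNoetherianRing R] [IsLocalRing R] (z : R) (hz : z ≠ 0)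
    (hz2 : ∀ r ∈ maximalIdeal R, r * z = 0) (n : ℕ) : ∀ (N : Type) [AddCommGroup N] [Module R N]
    [Module.Finite R N], PD R N (n+1) → Module.Projective R N := by
  induction n with
  | zero => intro N _ _ _ h; exact PD_one_iff.1 h
  | succ n ih =>
    intro N _ _ _ h
    obtain ⟨m, g, hg⟩ := Module.Finite.exists_fin' R N
    have hK := ih _ (PD_ker h g hg)
    have : Module.Free R (LinearMap.ker g) := Module.free_of_flat_of_isLocalRing
    have hs := split_of_depth_zero z hz hz2 (LinearMap.ker g).subtype (Submodule.injective_subtype _)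
    have := ((LinearMap.exact_subtype_ker_map g).split_tfae (Submodule.injective_subtype _) hg).out 1 0
    obtain ⟨l, hl⟩ := this.1 hs
    exact Module.Projective.of_split l g hl

lemma regular_of_max_bot [IsNoetherianRing R] [IsLocalRing R] (h : maximalIdeal R = ⊥) :
    IsRegularLocal R := by
  refine ⟨inferInstance, ∅, by simp [h], ?_⟩
  have := (IsLocalRing.isField_iff_maximalIdeal_eq.mpr h)
  rw [ringKrullDim_eq_zero_of_isField this]; rfl

lemma max_bot_of_projective [IsLocalRing R] [IsNoetherianRing R]
    (h : Module.Projective R (R ⧸ maximalIdeal R)) :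
    maximalIdeal R = ⊥ := by
  have hf : Module.Free R (R ⧸ maximalIdeal R) := Module.free_of_flat_of_isLocalRing
  have : Nontrivial (R ⧸ maximalIdeal R) :=
    Ideal.Quotient.nontrivial_iff.mpr (maximalIdeal.isMaximal R).ne_top
  let b := Module.Free.chooseBasis R (R ⧸ maximalIdeal R)
  obtain ⟨i⟩ : Nonempty (Module.Free.ChooseBasisIndex R (R ⧸ maximalIdeal R)) := b.index_nonempty
  rw [eq_bot_iff]
  intro r hr
  have := DFunLike.congr_fun (congrArg b.repr (quot_smul_zero _ r hr (b i))) i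
  simpa using this

lemma exists_functional [IsLocalRing R] [IsNoetherianRing R] (x : R) (hx : x ∈ maximalIdeal R)
    (hx2 : x ∉ maximalIdeal R ^ 2) :
    ∃ φ : maximalIdeal R →ₗ[R] (ResidueField R), φ ⟨x, hx⟩ = 1 ∧
      ∀ y : maximalIdeal R, (y : R) ∈ maximalIdeal R ^ 2 → φ y = 0 := by
  have hne : (maximalIdeal R).toCotangent ⟨x, hx⟩ ≠ 0 := by
    rw [Ne, Ideal.toCotangent_eq_zero]; exact hx2
  have := (Module.forall_dual_apply_eq_zero_iff (ResidueField R)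
    (V := CotangentSpace R) ((maximalIdeal R).toCotangent ⟨x, hx⟩)).not.2 hne
  push Not at this
  obtain ⟨ψ, hψ⟩ := this
  set c := ψ ((maximalIdeal R).toCotangent ⟨x, hx⟩)
  let ψ' : CotangentSpace R →ₗ[R] ResidueField R := (c⁻¹ • ψ).restrictScalars R
  refine ⟨ψ' ∘ₗ (maximalIdeal R).toCotangent, ?_, ?_⟩
  · show c⁻¹ * c = 1
    exact inv_mul_cancel₀ hψ
  · intro y hy
    rw [LinearMap.comp_apply, (Ideal.toCotangent_eq_zero _ y).2 hy, map_zero]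

open Pointwise in
lemma PD_residue_quot [IsLocalRing R] [IsNoetherianRing R] (x : R) (hx : x ∈ maximalIdeal R)
    (hx2 : x ∉ maximalIdeal R ^ 2) [IsLocalRing (R ⧸ Ideal.span {x})] (n : ℕ)
    (h : PD (R ⧸ Ideal.span {x}) (QuotSMulTop x (maximalIdeal R)) n) :
    PD (R ⧸ Ideal.span {x})
      ((R ⧸ Ideal.span {x}) ⧸ maximalIdeal (R ⧸ Ideal.span {x})) n := by
  obtain ⟨φ, hφ1, hφ2⟩ := exists_functional x hx hx2
  have hs : Function.Surjective (algebraMap R (R ⧸ Ideal.span {x})) :=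
    Ideal.Quotient.mk_surjective
  let v : QuotSMulTop x (maximalIdeal R) := Submodule.Quotient.mk ⟨x, hx⟩
  have hkv : ∀ r ∈ maximalIdeal R, r • v = 0 := by
    intro r hr
    have : r • v = Submodule.Quotient.mk (r • ⟨x, hx⟩ : maximalIdeal R) := rfl
    rw [this, Submodule.Quotient.mk_eq_zero]
    have e : (r • ⟨x, hx⟩ : maximalIdeal R) = x • ⟨r, hr⟩ := by
      ext; exact mul_comm _ _
    rw [e]
    exact Submodule.smul_mem_pointwise_smul _ _ _ trivial
  have hv : v ≠ 0 := by
    intro h0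
    rw [Submodule.Quotient.mk_eq_zero] at h0
    obtain ⟨y, -, hy⟩ := h0
    have : x * y = x := congrArg Subtype.val hy
    apply hx2
    rw [← this, pow_two]
    exact Ideal.mul_mem_mul hx y.2
  let P := Submodule.span (R ⧸ Ideal.span {x}) {v}
  let w : P := ⟨v, Submodule.mem_span_singleton_self v⟩
  have hkw : ∀ r ∈ maximalIdeal R, r • w = 0 := fun r hr => Subtype.ext (hkv r hr)
  let η : (R ⧸ maximalIdeal R) →ₗ[R] P :=
    (maximalIdeal R).liftQ (LinearMap.toSpanSingleton R P w) (fun r hr => hkw r hr)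
  let r0 : maximalIdeal R →ₗ[R] P := η ∘ₗ φ
  have hr0 : x • (⊤ : Submodule R (maximalIdeal R)) ≤ LinearMap.ker r0 := by
    rintro _ ⟨y, -, rfl⟩
    have : φ (x • y) = 0 := by
      apply hφ2
      rw [pow_two]
      exact Ideal.mul_mem_mul hx y.2
    show η (φ (x • y)) = 0
    rw [this]
    exact map_zero η
  let r1 : QuotSMulTop x (maximalIdeal R) →ₗ[R] P := Submodule.liftQ _ r0 hr0
  let r := r1.extendScalarsOfSurjective hs
  have hrv : r v = w := by
    show η (φ ⟨x, hx⟩) = w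
    rw [hφ1]
    show (1 : R) • w = w
    exact one_smul _ _
  have hP : PD (R ⧸ Ideal.span {x}) P n := by
    refine PD_retract h P.subtype r ?_
    rintro ⟨y, hy⟩
    obtain ⟨c, rfl⟩ := Submodule.mem_span_singleton.1 hy
    show r (c • v) = _
    rw [map_smul, hrv]; rfl
  refine PD_residue_of_cyclic hP w (fun h0 => hv (congrArg Subtype.val h0)) ?_ ?_
  · rintro ⟨y, hy⟩
    obtain ⟨c, rfl⟩ := Submodule.mem_span_singleton.1 hy
    exact ⟨c, rfl⟩
  · intro c hc
    rw [← IsLocalRing.map_maximalIdeal_of_surjective (Ideal.Quotient.mk (Ideal.span {x}))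
        Ideal.Quotient.mk_surjective] at hc
    obtain ⟨c', hc', rfl⟩ := (Ideal.mem_map_iff_of_surjective _ Ideal.Quotient.mk_surjective).1 hc
    exact hkw c' hc'

lemma regular_of_quot [IsLocalRing R] [IsNoetherianRing R] (x : R) (hx : x ∈ maximalIdeal R)
    (hreg : IsSMulRegular R x) [IsLocalRing (R ⧸ Ideal.span {x})]
    (h : IsRegularLocal (R ⧸ Ideal.span {x})) : IsRegularLocal R := by
  obtain ⟨-, s, hs, hsc⟩ := h
  have hdim := ringKrullDim_quotient_span_singleton_succ_eq_ringKrullDim hreg hx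
  let σ : R ⧸ Ideal.span {x} → R := Function.surjInv Ideal.Quotient.mk_surjective
  have hσ : ∀ y, Ideal.Quotient.mk (Ideal.span {x}) (σ y) = y := Function.surjInv_eq _
  let t : Finset R := insert x (s.image σ)
  have ht : Ideal.span (t : Set R) = maximalIdeal R := by
    have hmap : Ideal.map (Ideal.Quotient.mk (Ideal.span {x})) (Ideal.span (t : Set R)) =
        maximalIdeal (R ⧸ Ideal.span {x}) := by
      rw [← hs, Ideal.map_span]
      simp only [t, Finset.coe_insert, Set.image_insert_eq, Finset.coe_image, Set.image_image, hσ,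
        Set.image_id']
      rw [Ideal.Quotient.eq_zero_iff_mem.mpr (Ideal.mem_span_singleton_self x),
        Ideal.span_insert_zero]
    have hle : Ideal.span {x} ≤ Ideal.span (t : Set R) :=
      Ideal.span_mono (by simp [t])
    have h1 := Ideal.comap_map_of_surjective _
      (Ideal.Quotient.mk_surjective (I := Ideal.span {x})) (Ideal.span (t : Set R))
    rw [hmap, ← RingHom.ker_eq_comap_bot, Ideal.mk_ker, sup_eq_left.2 hle] at h1
    rw [← h1]
    exact (IsLocalRing.eq_maximalIdeal (Ideal.comap_isMaximal_of_surjective _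
      Ideal.Quotient.mk_surjective))
  have hcard : t.card ≤ s.card + 1 :=
    (Finset.card_insert_le _ _).trans (Nat.add_le_add_right Finset.card_image_le 1)
  have h1 : ringKrullDim R ≤ (maximalIdeal R).spanFinrank :=
    ringKrullDim_le_spanFinrank_maximalIdeal R
  have h2 : (maximalIdeal R).spanFinrank ≤ t.card := by
    rw [← ht, ← Set.ncard_coe_finset]
    exact Submodule.spanFinrank_span_le_ncard_of_finite t.finite_toSet
  refine ⟨inferInstance, t, ht, ?_⟩
  have h3 : ((s.card + 1 : ℕ) : WithBot ℕ∞) = ringKrullDim R := by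
    rw [← hdim, ← hsc]; rfl
  have h4 : s.card + 1 ≤ t.card := by
    rw [← h3] at h1
    exact (ENat.natCast_le_natCast.mp (WithBot.coe_le_coe.mp h1)).trans h2
  rw [← h3, le_antisymm hcard h4]; rfl

lemma exists_socle [IsLocalRing R] [IsNoetherianRing R]
    (h : ¬ ∃ r ∈ maximalIdeal R, IsSMulRegular R r) :
    ∃ z : R, z ≠ 0 ∧ ∀ r ∈ maximalIdeal R, r * z = 0 := by
  have h1 : (maximalIdeal R : Set R) ⊆ ⋃ p ∈ associatedPrimes R R, (p : Set R) := by
    rw [biUnion_associatedPrimes_eq_compl_regular]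
    intro r hr hreg
    exact h ⟨r, hr, hreg⟩
  have h2 := (Ideal.subset_union_prime_finite (associatedPrimes.finite R R) (f := id) ⊥ ⊥
    (fun p hp _ _ => hp.isPrime)).1 h1
  obtain ⟨p, hp, hle⟩ := h2
  obtain ⟨hpp, z, hz⟩ := Submodule.isAssociatedPrime_iff.1 hp
  refine ⟨z, ?_, ?_⟩
  · rintro rfl
    apply hpp.ne_top
    rw [hz]
    exact (Ideal.eq_top_iff_one _).2 (Submodule.mem_colon_singleton.2 (by simp))
  · intro r hr
    have h3 : r ∈ p := hle hr
    rw [hz] at h3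
    simpa using Submodule.mem_colon_singleton.1 h3

lemma serre_step (R : Type) [CommRing R] [IsNoetherianRing R] [IsLocalRing R] (n : ℕ)
    (hn : PD R (R ⧸ maximalIdeal R) n) :
    IsRegularLocal R ∨ ∃ x ∈ maximalIdeal R, IsSMulRegular R x ∧
      ∀ [IsLocalRing (R ⧸ Ideal.span {x})], PD (R ⧸ Ideal.span {x})
        ((R ⧸ Ideal.span {x}) ⧸ maximalIdeal (R ⧸ Ideal.span {x})) (n + 1) := by
  by_cases hr : ∃ r ∈ maximalIdeal R, IsSMulRegular R r
  · by_cases hsq : maximalIdeal R ≤ maximalIdeal R ^ 2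
    · exact Or.inl (regular_of_max_bot (max_eq_bot_of_le_sq hsq))
    · obtain ⟨x, hx, hx2, hreg⟩ := exists_regular_notMem R hr hsq
      refine Or.inr ⟨x, hx, hreg, ?_⟩
      intro _
      apply PD_residue_quot x hx hx2
      have hreg' : IsSMulRegular (maximalIdeal R) x := by
        intro a b hab
        exact Subtype.ext (hreg (congrArg Subtype.val hab))
      apply PD_quot x hreg _ _ hreg'
      exact PD_ses1 (maximalIdeal R).subtype (maximalIdeal R).mkQ
        (Submodule.injective_subtype _) (LinearMap.exact_subtype_mkQ _)
        (Submodule.mkQ_surjective _) (PD_mono (PD_one_iff.2 inferInstance) (by omega))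
        (PD_mono hn (by omega))
  · obtain ⟨z, hz, hz2⟩ := exists_socle hr
    left
    apply regular_of_max_bot
    apply max_bot_of_projective
    exact projective_of_depth_zero z hz hz2 n _ (PD_mono hn (by omega))

theorem serre_aux (d : ℕ) : ∀ (R : Type) [CommRing R] [IsNoetherianRing R] [IsLocalRing R],
    ringKrullDim R = d → ∀ n, PD R (R ⧸ maximalIdeal R) n → IsRegularLocal R := by
  induction d with
  | zero =>
    intro R _ _ _ hd n hn
    rcases serre_step R n hn with h | ⟨x, hx, hreg, -⟩
    · exact h
    · have hdim := ringKrullDim_quotient_span_singleton_succ_eq_ringKrullDim hreg hx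
      have := isLocalRing_quot hx
      obtain ⟨e, he⟩ := exists_nat_dim (ringKrullDim (R ⧸ Ideal.span {x})) ringKrullDim_ne_bot
        ringKrullDim_ne_top
      rw [he, hd] at hdim
      have : ((e + 1 : ℕ) : WithBot ℕ∞) = ((0 : ℕ) : WithBot ℕ∞) := hdim
      have := ENat.natCast_le_natCast.mp (WithBot.coe_le_coe.mp this.le)
      omega
  | succ d ih =>
    intro R _ _ _ hd n hn
    rcases serre_step R n hn with h | ⟨x, hx, hreg, hP⟩
    · exact h
    · have hdim := ringKrullDim_quotient_span_singleton_succ_eq_ringKrullDim hreg hx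
      have := isLocalRing_quot hx
      obtain ⟨e, he⟩ := exists_nat_dim (ringKrullDim (R ⧸ Ideal.span {x})) ringKrullDim_ne_bot
        ringKrullDim_ne_top
      rw [he, hd] at hdim
      have h0 : ((e + 1 : ℕ) : WithBot ℕ∞) = ((d + 1 : ℕ) : WithBot ℕ∞) := hdim
      have h1 := ENat.natCast_le_natCast.mp (WithBot.coe_le_coe.mp h0.le)
      have h2 := ENat.natCast_le_natCast.mp (WithBot.coe_le_coe.mp h0.ge)
      have h3 : e = d := by omega
      subst h3
      exact regular_of_quot x hx hreg (ih _ he _ hP)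

theorem serre (R : Type) [CommRing R] [IsNoetherianRing R] [IsLocalRing R]
    (n : ℕ) (hn : PD R (R ⧸ maximalIdeal R) n) : IsRegularLocal R := by
  obtain ⟨e, he⟩ := exists_nat_dim (ringKrullDim R) ringKrullDim_ne_bot ringKrullDim_ne_top
  exact serre_aux e R he n hn

end PartC2

section PartD
open IsLocalRing

lemma proj_loc_of_fac {S : Type} [CommRing S] (p : Ideal S) [p.IsPrime] {N F : Type}
    [AddCommGroup N] [Module S N] [AddCommGroup F] [Module S F] [Module.Projective S F]
    (g : N →ₗ[S] F) (h : F →ₗ[S] N) (s : S) (hs : s ∉ p) (hgh : ∀ x, h (g x) = s • x) :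
    Module.Projective (Localization.AtPrime p) (LocalizedModule p.primeCompl N) := by
  have hP : Module.Projective (Localization.AtPrime p) (LocalizedModule p.primeCompl F) :=
    inferInstanceAs (Module.Projective (Localization p.primeCompl) (LocalizedModule p.primeCompl F))
  let g' := LocalizedModule.map p.primeCompl g
  let h' := LocalizedModule.map p.primeCompl h
  let u : Localization.AtPrime p := Localization.mk 1 ⟨s, hs⟩
  refine Module.Projective.of_split (u • g') h' ?_
  ext x
  induction x using LocalizedModule.induction_on with
  | h a t =>
    show h' (u • g' (LocalizedModule.mk a t)) = LocalizedModule.mk a t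
    rw [map_smul]
    rw [show g' (LocalizedModule.mk a t) = LocalizedModule.mk (g a) t from
        LocalizedModule.map_mk _ _ _ _,
      show h' (LocalizedModule.mk (g a) t) = LocalizedModule.mk (h (g a)) t from
        LocalizedModule.map_mk _ _ _ _, hgh, LocalizedModule.mk_smul_mk, one_smul]
    exact LocalizedModule.mk_cancel_common_left ⟨s, hs⟩ t a

lemma fac_of_proj_loc {S : Type} [CommRing S] [IsNoetherianRing S] (p : Ideal S) [p.IsPrime]
    {N : Type} [AddCommGroup N] [Module S N] [Module.Finite S N]
    (hP : Module.Projective (Localization.AtPrime p) (LocalizedModule p.primeCompl N)) :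
    ∃ s, s ∉ p ∧ ∃ (n : ℕ) (g : N →ₗ[S] (Fin n → S)) (h : (Fin n → S) →ₗ[S] N),
      ∀ x, h (g x) = s • x := by
  obtain ⟨n, π, hπ⟩ := Module.Finite.exists_fin' S N
  let π' : LocalizedModule p.primeCompl (Fin n → S) →ₗ[Localization.AtPrime p]
    LocalizedModule p.primeCompl N := LocalizedModule.map p.primeCompl π
  have hπ' : Function.Surjective π' := LocalizedModule.map_surjective p.primeCompl π hπ
  obtain ⟨σ, hσ⟩ := Module.projective_lifting_property π' LinearMap.id hπ'
  have : Module.FinitePresentation S N := Module.finitePresentation_of_finite S N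
  obtain ⟨g, s, hg⟩ := Module.FinitePresentation.exists_lift_of_isLocalizedModule p.primeCompl
    (LocalizedModule.mkLinearMap p.primeCompl (Fin n → S))
    ((σ.restrictScalars S) ∘ₗ (LocalizedModule.mkLinearMap p.primeCompl N))
  have H : (LocalizedModule.mkLinearMap p.primeCompl N) ∘ₗ (π ∘ₗ g) =
    (LocalizedModule.mkLinearMap p.primeCompl N) ∘ₗ (s • LinearMap.id) := by
    ext x
    have h1 := congrArg π' (LinearMap.congr_fun hg x)
    have h2 : π' ((s : S) • σ (LocalizedModule.mkLinearMap p.primeCompl N x)) =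
        (s : S) • LocalizedModule.mkLinearMap p.primeCompl N x := by
      rw [LinearMap.map_smul_of_tower]
      congr 1
      exact LinearMap.congr_fun hσ _
    have h3 : LocalizedModule.mkLinearMap p.primeCompl N (π (g x)) =
      (s : S) • LocalizedModule.mkLinearMap p.primeCompl N x :=
      (LocalizedModule.map_mk _ π (g x) 1).symm.trans (h1.trans h2)
    rw [← map_smul] at h3
    exact h3
  obtain ⟨t, ht⟩ := Module.Finite.exists_smul_of_comp_eq_of_isLocalizedModule p.primeCompl
    (LocalizedModule.mkLinearMap p.primeCompl N) _ _ H
  refine ⟨t * s, (t * s).2, n, g, (t : S) • π, fun x => ?_⟩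
  have := LinearMap.congr_fun ht x
  rw [mul_smul]
  exact this

def facIdeal (S : Type) [CommRing S] (M : Type) [AddCommGroup M] [Module S M] :
    TwoSidedIdeal (Module.End S M) :=
  TwoSidedIdeal.mk' {f | FactorsThroughProj S f}
    ⟨ModuleCat.of S S, 0, 0, inferInstanceAs (Module.Finite S S),
      inferInstanceAs (Module.Projective S S), by ext; simp⟩
    (by
      rintro _ _ ⟨P, g, h, h1, h2, rfl⟩ ⟨P', g', h', h1', h2', rfl⟩
      refine ⟨ModuleCat.of S (P × P'), g.prod g', h.coprod h',
        inferInstanceAs (Module.Finite S (P × P')), 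
        inferInstanceAs (Module.Projective S (P × P')), ?_⟩
      ext x
      rfl)
    (by
      rintro _ ⟨P, g, h, h1, h2, rfl⟩
      refine ⟨P, g, -h, h1, h2, ?_⟩
      ext x
      rfl)
    (by
      rintro f _ ⟨P, g, h, h1, h2, rfl⟩
      exact ⟨P, g, f ∘ₗ h, h1, h2, rfl⟩)
    (by
      rintro _ f ⟨P, g, h, h1, h2, rfl⟩
      exact ⟨P, g ∘ₗ f, h, h1, h2, rfl⟩)

lemma mem_facIdeal {S : Type} [CommRing S] {M : Type} [AddCommGroup M] [Module S M]
    (f : Module.End S M) : f ∈ facIdeal S M ↔ FactorsThroughProj S f :=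
  TwoSidedIdeal.mem_mk' _ _ _ _ _ _ _

lemma fac_of_mem_J (S : Type) [CommRing S] (m : ℕ) (M : Fin (m + 1) → ModuleCat.{0} S)
    (e0 : ↥(M 0) ≃ₗ[S] S) (s : S) (hs : s ∈ idealJ S m M) :
    ∃ (n : ℕ) (g : DirSum S m M →ₗ[S] (Fin n → S)) (h : (Fin n → S) →ₗ[S] DirSum S m M),
      ∀ x, h (g x) = s • x := by
  have h1 : TwoSidedIdeal.span {idemZero S m M} ≤ facIdeal S (DirSum S m M) := by
    rw [TwoSidedIdeal.span_le]
    rintro _ rfl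
    show _ ∈ facIdeal _ _
    rw [mem_facIdeal]
    exact ⟨M 0, _, _, Module.Finite.equiv e0.symm, Module.Projective.of_equiv e0.symm, rfl⟩
  have h2 := h1 hs
  rw [mem_facIdeal] at h2
  obtain ⟨P, g, h, hf, hp, hgh⟩ := h2
  obtain ⟨n, a, b, -, -, hab⟩ := Module.Finite.exists_comp_eq_id_of_projective S P
  refine ⟨n, b ∘ₗ g, h ∘ₗ a, fun x => ?_⟩
  show h (a (b (g x))) = _
  have := LinearMap.congr_fun hab (g x)
  rw [LinearMap.comp_apply] at this
  rw [this]
  exact LinearMap.congr_fun hgh x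

lemma mem_J_of_fac (S : Type) [CommRing S] (m : ℕ) (M : Fin (m + 1) → ModuleCat.{0} S)
    (e0 : ↥(M 0) ≃ₗ[S] S) (s : S)
    (H : ∀ i, ∃ (n : ℕ) (g : M i →ₗ[S] (Fin n → S)) (h : (Fin n → S) →ₗ[S] M i),
      ∀ x, h (g x) = s • x) : s ∈ idealJ S m M := by
  show scalarEnd S (DirSum S m M) s ∈ TwoSidedIdeal.span {idemZero S m M}
  have hmem : idemZero S m M ∈ TwoSidedIdeal.span {idemZero S m M} :=
    TwoSidedIdeal.subset_span rfl
  have key : ∀ (a : S →ₗ[S] DirSum S m M) (b : DirSum S m M →ₗ[S] S),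
      a ∘ₗ b ∈ TwoSidedIdeal.span {idemZero S m M} := by
    intro a b
    have e : (a ∘ₗ b : Module.End S (DirSum S m M)) =
        ((a ∘ₗ e0.toLinearMap ∘ₗ LinearMap.proj 0 : Module.End S (DirSum S m M)) *
        idemZero S m M) *
        (LinearMap.single S (fun i => ↥(M i)) 0 ∘ₗ e0.symm.toLinearMap ∘ₗ b :
          Module.End S (DirSum S m M)) := by
      refine LinearMap.ext fun x => ?_
      simp [idemZero, Module.End.mul_apply]
    rw [e]
    exact TwoSidedIdeal.mul_mem_right _ _ _ (TwoSidedIdeal.mul_mem_left _ _ _ hmem)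
  choose n g h hgh using H
  have e : scalarEnd S (DirSum S m M) s = ∑ i, ∑ j : Fin (n i),
      ((LinearMap.single S (fun i => ↥(M i)) i ∘ₗ h i ∘ₗ LinearMap.single S (fun _ => S) j) ∘ₗ
        (LinearMap.proj j ∘ₗ g i ∘ₗ LinearMap.proj i) : Module.End S (DirSum S m M)) := by
    refine LinearMap.ext fun x => ?_
    show s • x = _
    simp only [LinearMap.sum_apply, LinearMap.comp_apply, ← map_sum]
    have : ∀ i, ∑ j : Fin (n i), LinearMap.single S (fun _ => S) j
        (LinearMap.proj (R := S) (φ := fun _ => S) j (g i (x i))) = g i (x i) := fun i => by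
      ext k
      simp [Finset.sum_apply, Pi.single_apply]
    ext k
    have h2 : ∀ i, LinearMap.proj (R := S) (φ := fun i => ↥(M i)) i x = x i := fun i => rfl
    simp only [h2, this, hgh]
    rw [Finset.sum_apply, Finset.sum_eq_single k]
    · exact (Pi.single_eq_same (M := fun i => ↥(M i)) k (s • x k)).symm
    · intro b _ hb
      exact Pi.single_eq_of_ne hb.symm _
    · exact fun h => absurd (Finset.mem_univ k) h
  rw [e]
  exact sum_mem fun i _ => sum_mem fun j _ => key _ _

theorem exists_mem_J_of_regular (S : Type) [CommRing S] [IsNoetherianRing S] (m : ℕ)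
    (M : Fin (m + 1) → ModuleCat.{0} S)
    (e0 : ↥(M 0) ≃ₗ[S] S)
    (hfg : ∀ i, Module.Finite S ↥(M i)) (hCM : ∀ i, IsMCM S ↥(M i)) (p : Ideal S) [p.IsPrime]
    (hreg : IsRegularLocal (Localization.AtPrime p)) : ∃ s ∈ idealJ S m M, s ∉ p := by
  have H : ∀ i, ∃ s, s ∉ p ∧ ∃ (n : ℕ) (g : M i →ₗ[S] (Fin n → S)) (h : (Fin n → S) →ₗ[S] M i),
      ∀ x, h (g x) = s • x := fun i => by
    have := hfg i
    have h := mcm_loc_free S (M i) (hCM i) p hreg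
    exact fac_of_proj_loc p (@Module.Projective.of_free _ _ _ _ _ h)
  choose s hs n g h hgh using H
  refine ⟨∏ i, s i, mem_J_of_fac S m M e0 _ fun i => ?_, ?_⟩
  · obtain ⟨c, hc⟩ := Finset.dvd_prod_of_mem s (Finset.mem_univ i)
    refine ⟨n i, g i, c • h i, fun x => ?_⟩
    rw [LinearMap.smul_apply, hgh, hc, smul_smul, mul_comm]
  · intro hp
    obtain ⟨i, -, hi⟩ := (Ideal.IsPrime.prod_mem_iff).1 hp
    exact hs i hi
end PartD

section PartE
open IsLocalRing TensorProduct

lemma proj_loc_of_proj {S A : Type} [CommRing S] [Ring A] [Algebra S A] (p : Ideal S) [p.IsPrime]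
    {F : Type} [AddCommGroup F] [Module S F] [Module.Free S F]
    (g : A →ₗ[S] F) (h : F →ₗ[S] A) (s : S) (hs : s ∉ p) (hgh : ∀ x, h (g x) = s • x)
    (P : Type) [AddCommGroup P] [Module A P] [Module S P] [IsScalarTower S A P]
    [hP : Module.Projective A P] :
    Module.Projective (Localization.AtPrime p) (LocalizedModule p.primeCompl P) := by
  obtain ⟨σ, hσ⟩ := Module.projective_def'.1 hP
  let G : P →ₗ[S] (P →₀ F) := Finsupp.mapRange.linearMap g ∘ₗ σ.restrictScalars S
  let H : (P →₀ F) →ₗ[S] P :=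
    (Finsupp.linearCombination A id).restrictScalars S ∘ₗ Finsupp.mapRange.linearMap h
  refine proj_loc_of_fac p G H s hs fun x => ?_
  show Finsupp.linearCombination A id (Finsupp.mapRange.linearMap h
    (Finsupp.mapRange.linearMap g (σ x))) = _
  have : Finsupp.mapRange.linearMap h (Finsupp.mapRange.linearMap g (σ x)) = s • σ x := by
    ext i
    simp [hgh]
  rw [this, LinearMap.map_smul_of_tower]
  congr 1
  exact LinearMap.congr_fun hσ x

lemma PD_of_syz {S A : Type} [CommRing S] [Ring A] [Algebra S A] (p : Ideal S) [p.IsPrime]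
    (H : ∀ (P : Type) [AddCommGroup P] [Module A P] [Module S P] [IsScalarTower S A P]
      [Module.Projective A P],
      Module.Projective (Localization.AtPrime p) (LocalizedModule p.primeCompl P)) (d : ℕ) :
    ∀ (X : Type) [AddCommGroup X] [Module A X] [Module S X] [IsScalarTower S A X],
      (∀ P : ModuleCat.{0} A, IsSyzygyIter A d P (ModuleCat.of A X) → Module.Projective A P) →
      PD (Localization.AtPrime p) (LocalizedModule p.primeCompl X) (d + 1) := by
  induction d with
  | zero =>
    intro X _ _ _ _ h
    rw [PD_one_iff]
    have : Module.Projective A X := h (ModuleCat.of A X) ⟨LinearEquiv.refl A X⟩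
    exact H X
  | succ d ih =>
    intro X _ _ _ _ h
    let f : (X →₀ A) →ₗ[A] X := Finsupp.linearCombination A id
    have hf : Function.Surjective f := Finsupp.linearCombination_id_surjective A X
    have hK := ih (LinearMap.ker f) (fun P hP => h P
      ⟨ModuleCat.of A (LinearMap.ker f), ⟨X, f, hf, ⟨LinearEquiv.refl A _⟩⟩, hP⟩)
    have hF := H (X →₀ A)
    let ι : LinearMap.ker f →ₗ[S] (X →₀ A) := (LinearMap.ker f).subtype.restrictScalars S
    let f' : (X →₀ A) →ₗ[S] X := f.restrictScalars S
    have hex : Function.Exact ι f' := LinearMap.exact_subtype_ker_map f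
    exact PD_ses3 (LocalizedModule.map p.primeCompl ι) (LocalizedModule.map p.primeCompl f')
      (LocalizedModule.map_injective p.primeCompl ι (Submodule.injective_subtype _))
      (LocalizedModule.map_exact p.primeCompl ι f' hex)
      (LocalizedModule.map_surjective p.primeCompl f' hf) hK
      (PD_mono (PD_one_iff.2 hF) (by omega))

lemma PD_residue_of_quot {S : Type} [CommRing S] (p : Ideal S) [p.IsPrime] (n : ℕ)
    (h : PD (Localization.AtPrime p) (LocalizedModule p.primeCompl (S ⧸ p)) n) :
    PD (Localization.AtPrime p)
      (Localization.AtPrime p ⧸ maximalIdeal (Localization.AtPrime p)) n := by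
  refine PD_residue_of_cyclic h (LocalizedModule.mk (Ideal.Quotient.mk p 1) 1) ?_ ?_ ?_
  · intro h0
    obtain ⟨u, hu⟩ := (LocalizedModule.mk_eq.1 (h0.trans (LocalizedModule.zero_mk 1).symm))
    rw [smul_zero, smul_zero, one_smul] at hu
    have : Ideal.Quotient.mk p ((u : S) * 1) = 0 := hu
    rw [mul_one, Ideal.Quotient.eq_zero_iff_mem] at this
    exact u.2 this
  · intro y
    induction y using LocalizedModule.induction_on with
    | h a t =>
      obtain ⟨a, rfl⟩ := Ideal.Quotient.mk_surjective a
      refine ⟨Localization.mk a t, ?_⟩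
      rw [LocalizedModule.mk_smul_mk, mul_one]
      congr 1
      show Ideal.Quotient.mk p (a * 1) = _
      rw [mul_one]
  · intro r hr
    induction r using Localization.induction_on with
    | H y =>
      obtain ⟨a, t⟩ := y
      have ha : a ∈ p := by
        rw [← Localization.AtPrime.comap_maximalIdeal (I := p), Ideal.mem_comap]
        have : algebraMap S (Localization.AtPrime p) a =
          algebraMap S (Localization.AtPrime p) t * Localization.mk a t := by
          rw [Localization.mk_eq_mk', IsLocalization.mul_mk'_eq_mk'_of_mul,
            IsLocalization.mk'_mul_cancel_left]
        rw [this]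
        exact Ideal.mul_mem_left _ _ hr
      rw [LocalizedModule.mk_smul_mk]
      have : a • Ideal.Quotient.mk p 1 = 0 := quot_smul_zero p a ha _
      rw [this, LocalizedModule.zero_mk]

theorem regular_of_fac (S : Type) [CommRing S] [IsNoetherianRing S] (M : Type) [AddCommGroup M]
    [Module S M] (u : S →ₗ[S] M) (v : M →ₗ[S] S) (huv : ∀ x, v (u x) = x)
    (hNCR : HasFiniteGlobalDim (Module.End S M)) (p : Ideal S) [p.IsPrime]
    (s : S) (hs : s ∉ p) (n : ℕ) (g : M →ₗ[S] (Fin n → S)) (h : (Fin n → S) →ₗ[S] M)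
    (hgh : ∀ x, h (g x) = s • x) : IsRegularLocal (Localization.AtPrime p) := by
  obtain ⟨d, hd⟩ := hNCR
  let G : Module.End S M →ₗ[S] ((Fin n → S) →ₗ[S] (Fin n → S)) :=
    (LinearMap.lcomp S (Fin n → S) h) ∘ₗ (LinearMap.llcomp S M M (Fin n → S) g)
  let H : ((Fin n → S) →ₗ[S] (Fin n → S)) →ₗ[S] Module.End S M :=
    (LinearMap.lcomp S M g) ∘ₗ (LinearMap.llcomp S (Fin n → S) (Fin n → S) M h)
  have hGH : ∀ f, H (G f) = (s * s) • f := by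
    intro f
    ext x
    show h (g (f (h (g x)))) = (s * s) • f x
    rw [hgh, hgh, map_smul, mul_smul]
  have hss : s * s ∉ p := fun hc => (Ideal.IsPrime.mem_or_mem ‹_› hc).elim hs hs
  have h1 := PD_of_syz (A := Module.End S M) p
    (fun P _ _ _ _ _ => proj_loc_of_proj p G H (s * s) hss hGH P) d (M ⊗[S] (S ⧸ p))
    (fun P hP => hd _ P hP)
  have : IsNoetherianRing (Localization.AtPrime p) :=
    IsLocalization.isNoetherianRing p.primeCompl _ inferInstance
  refine serre _ (d + 1) (PD_residue_of_quot p _ ?_)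
  let i : (S ⧸ p) →ₗ[S] M ⊗[S] (S ⧸ p) :=
    LinearMap.rTensor (S ⧸ p) u ∘ₗ (TensorProduct.lid S (S ⧸ p)).symm.toLinearMap
  let r : M ⊗[S] (S ⧸ p) →ₗ[S] (S ⧸ p) :=
    (TensorProduct.lid S (S ⧸ p)).toLinearMap ∘ₗ LinearMap.rTensor (S ⧸ p) v
  have hir : ∀ x, r (i x) = x := by
    intro x
    simp [i, r, huv]
  refine PD_retract h1 (LocalizedModule.map p.primeCompl i) (LocalizedModule.map p.primeCompl r) ?_
  intro x
  induction x using LocalizedModule.induction_on with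
  | h a t => rw [LocalizedModule.map_mk, LocalizedModule.map_mk, hir]
end PartE

section PartF
open IsLocalRing

theorem main_aux
    (S : Type) [CommRing S] [IsNoetherianRing S]
    (m : ℕ) (M : Fin (m + 1) → ModuleCat.{0} S)
    (e0 : ↥(M 0) ≃ₗ[S] S)
    (hfg : ∀ i, Module.Finite S ↥(M i)) (hCM : ∀ i, IsMCM S ↥(M i))
    (hNCR : HasFiniteGlobalDim (Module.End S (DirSum S m M))) :
    (idealJ S m M).radical = PrimeSpectrum.vanishingIdeal (singularSet S) := by
  rw [← PrimeSpectrum.vanishingIdeal_zeroLocus_eq_radical]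
  congr 1
  ext p
  rw [PrimeSpectrum.mem_zeroLocus, ← not_iff_not]
  have h1 : p ∉ singularSet S ↔ IsRegularLocal (Localization.AtPrime p.asIdeal) := not_not
  rw [h1, SetLike.coe_subset_coe, SetLike.not_le_iff_exists]
  constructor
  · rintro ⟨s, hs, hsp⟩
    obtain ⟨n, g, h, hgh⟩ := fac_of_mem_J S m M e0 s hs
    refine regular_of_fac S (DirSum S m M)
      (LinearMap.single S (fun i => ↥(M i)) 0 ∘ₗ e0.symm.toLinearMap)
      (e0.toLinearMap ∘ₗ LinearMap.proj 0) ?_ hNCR p.asIdeal s hsp n g h hgh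
    intro x
    simp
  · intro hreg
    exact exists_mem_J_of_regular S m M e0 hfg hCM p.asIdeal hreg
end PartF

/-- **Statement 6.** With the setup of Statement 5 (`Λ = End_S(⊕ M_i)` a non-commutative
resolution of the Gorenstein normal domain `S`, `φ : S ↪ Λ`, and `e` the idempotent of the
summand `S = M_0`), the reduced singular locus satisfies
`√Sing(Spec S) ≅ Spec(φ(S)/√(φ(S) ∩ ΛeΛ))` as (reduced closed) subschemes of `Spec S`;
equivalently, the radical of `φ(S) ∩ ΛeΛ` equals the vanishing ideal of the singular
locus. -/
theorem statement_6 (k : Type) [Field k] [IsAlgClosed k] [CharZero k]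
    (S : Type) [CommRing S] [Algebra k S] [IsNoetherianRing S]
    (hdom : IsDomain S) (hnormal : IsIntegrallyClosed S) (hGor : IsGorenstein S)
    (m : ℕ) (M : Fin (m + 1) → ModuleCat.{0} S)
    (e0 : ↥(M 0) ≃ₗ[S] S)
    (hfg : ∀ i, Module.Finite S ↥(M i)) (hCM : ∀ i, IsMCM S ↥(M i))
    (hind : ∀ i, IndecomposableMod S ↥(M i))
    (hrefl : Module.IsReflexive S (DirSum S m M))
    (hNCR : HasFiniteGlobalDim (Module.End S (DirSum S m M))) :
    (idealJ S m M).radical = PrimeSpectrum.vanishingIdeal (singularSet S) := by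
  exact main_aux S m M e0 hfg hCM hNCR

end
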